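/- arXiv:2406.03862 — 6 statements merged into one kernel-verified Lean document; each statement's English description precedes it below -/
import Mathlib

section
/- Let ν be an adversarial policy whose support respects B, i.e. ν(ŝ|s) > 0 implies ŝ ∈ B(s) for every s ∈ S. Then for every state s ∈ S, the value of ν in the constructed MDP M̂ equals the value of the composite policy in M: V̂_ν(s) = Ṽ_{π∘ν}(s). -/
open scoped BigOperators ENNReal

/-- A probability mass function on a finite type, as a real-valued function. -/
def IsPMF {X : Type*} [Fintype X] (q : X → ℝ) : Prop :=
  (∀ x, 0 ≤ q x) ∧ ∑ x, q x = 1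

/-- The composite policy `π∘ν`: `(π∘ν)(a|s) = Σ_ŝ ν(ŝ|s) π(a|ŝ)`. -/
def comp {S A : Type*} [Fintype S] (π : S → A → ℝ) (ν : S → S → ℝ) : S → A → ℝ :=
  fun s a => ∑ sh, ν s sh * π sh a

/-- Time-`t` state distribution of policy `π` with transitions `p`, started from `d0`. -/
def stateDist {S A : Type*} [Fintype S] [Fintype A] (π : S → A → ℝ)
    (p : S → A → S → ℝ) (d0 : S → ℝ) : ℕ → S → ℝ
  | 0 => d0
  | (t + 1) => fun s' => ∑ s, stateDist π p d0 t s * ∑ a, π s a * p s a s'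

/-- Expected one-step reward from state distribution `d`. -/
def stepReward {S A : Type*} [Fintype S] [Fintype A] (π : S → A → ℝ)
    (p : S → A → S → ℝ) (R : S → A → S → ℝ) (d : S → ℝ) : ℝ :=
  ∑ s, d s * ∑ a, π s a * ∑ s', p s a s' * R s a s'

/-- Expected discounted return `E[Σ_t γ^t R(s_t,a_t,s_{t+1})]` started from distribution `d0`. -/
noncomputable def valueFrom {S A : Type*} [Fintype S] [Fintype A] (γ : ℝ)
    (π : S → A → ℝ) (p : S → A → S → ℝ) (R : S → A → S → ℝ) (d0 : S → ℝ) : ℝ :=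
  ∑' t : ℕ, γ ^ t * stepReward π p R (stateDist π p d0 t)

/-- Value function: expected discounted return started from state `s0`. -/
noncomputable def value {S A : Type*} [Fintype S] [Fintype A] [DecidableEq S] (γ : ℝ)
    (π : S → A → ℝ) (p : S → A → S → ℝ) (R : S → A → S → ℝ) (s0 : S) : ℝ :=
  valueFrom γ π p R (fun x => if x = s0 then 1 else 0)

/-- Transition kernel of the constructed MDP `M̂`: `p̂(s'|s,ŝ) = Σ_a π(a|ŝ) p(s'|s,a)`. -/
def phat {S A : Type*} [Fintype A] (π : S → A → ℝ) (p : S → A → S → ℝ) :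
    S → S → S → ℝ :=
  fun s sh s' => ∑ a, π sh a * p s a s'

/-- The point-mass (deterministic) adversarial policy associated to `f : S → S`. -/
def detPol {S : Type*} [DecidableEq S] (f : S → S) : S → S → ℝ :=
  fun s sh => if sh = f s then 1 else 0

open Classical in
/-- Kullback–Leibler divergence of finite pmfs, `+∞` when not absolutely continuous. -/
noncomputable def KL {X : Type*} [Fintype X] (P Q : X → ℝ) : ℝ≥0∞ :=
  if ∀ x, 0 < P x → 0 < Q x then ENNReal.ofReal (∑ x, P x * Real.log (P x / Q x)) else ⊤

/-- Normalized discounted state distribution `d_π = (1-γ) Σ_t γ^t d_π^t`. -/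
noncomputable def dDisc {S A : Type*} [Fintype S] [Fintype A] (γ : ℝ) (π : S → A → ℝ)
    (p : S → A → S → ℝ) (p0 : S → ℝ) : S → ℝ :=
  fun s => (1 - γ) * ∑' t : ℕ, γ ^ t * stateDist π p p0 t s

/-- Normalized discounted state–action distribution `ρ_π(s,a) = d_π(s) π(a|s)`. -/
noncomputable def rho {S A : Type*} [Fintype S] [Fintype A] (γ : ℝ) (π : S → A → ℝ)
    (p : S → A → S → ℝ) (p0 : S → ℝ) : S × A → ℝ :=
  fun z => dDisc γ π p p0 z.1 * π z.1 z.2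

/-- Unnormalized occupancy measure `ρ̂_π(s,a) = Σ_t γ^t Pr(s_t=s, a_t=a)`. -/
noncomputable def occ {S A : Type*} [Fintype S] [Fintype A] (γ : ℝ) (π : S → A → ℝ)
    (p : S → A → S → ℝ) (p0 : S → ℝ) : S × A → ℝ :=
  fun z => ∑' t : ℕ, γ ^ t * (stateDist π p p0 t z.1 * π z.1 z.2)

/-- Expected discounted cost `E_π[c] = Σ_{s,a} ρ̂_π(s,a) c(s,a)`. -/
noncomputable def Ecost {S A : Type*} [Fintype S] [Fintype A] (γ : ℝ) (π : S → A → ℝ)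
    (p : S → A → S → ℝ) (p0 : S → ℝ) (c : S × A → ℝ) : ℝ :=
  ∑ z : S × A, occ γ π p p0 z * c z

/-- Convex conjugate of `ψ` restricted to the set `C`. -/
noncomputable def psiStar {X : Type*} [Fintype X] (C : Set ((X → ℝ))) (ψ : (X → ℝ) → ℝ)
    (x : X → ℝ) : ℝ :=
  sSup ((fun c => (∑ z, x z * c z) - ψ c) '' C)

/-- if the support of the adversarial policy `ν` respects `B`, then the value of
`ν` in the constructed MDP `M̂` equals the value of the composite policy `π∘ν` in `M`. -/
theorem stmt0 {S A : Type*} [Fintype S] [Fintype A] [Nonempty S] [Nonempty A] [DecidableEq S]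
    (γ : ℝ) (hγ0 : 0 < γ) (hγ1 : γ < 1)
    (π : S → A → ℝ) (hπ : ∀ s, IsPMF (π s))
    (p : S → A → S → ℝ) (hp : ∀ s a, IsPMF (p s a))
    (B : S → Set S) (hB : ∀ s, (B s).Nonempty)
    (Rbar : S → A → S → ℝ) (C : ℝ)
    (Rhat : S → S → S → ℝ)
    (hRhat1 : ∀ s sh s', sh ∈ B s → 0 < phat π p s sh s' →
      Rhat s sh s' = (∑ a, π sh a * p s a s' * Rbar s a s') / phat π p s sh s')
    (hRhat2 : ∀ s sh s', sh ∉ B s → Rhat s sh s' = C)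
    (ν : S → S → ℝ) (hν : ∀ s, IsPMF (ν s))
    (hsupp : ∀ s sh, 0 < ν s sh → sh ∈ B s) :
    ∀ s : S, value γ ν (phat π p) Rhat s = value γ (comp π ν) p Rbar s := by
  have hd : ∀ (d0 : S → ℝ) (t : ℕ),
      stateDist ν (phat π p) d0 t = stateDist (comp π ν) p d0 t := by
    intro d0 t
    induction t with
    | zero => rfl
    | succ t ih =>
      funext s'
      simp only [stateDist]
      rw [ih]
      refine Finset.sum_congr rfl fun s _ => ?_
      congr 1
      simp only [phat, comp, Finset.mul_sum, Finset.sum_mul]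
      rw [Finset.sum_comm]
      simp only [mul_assoc]
  have hone : ∀ s sh s', sh ∈ B s →
      phat π p s sh s' * Rhat s sh s' = ∑ a, π sh a * p s a s' * Rbar s a s' := by
    intro s sh s' hs
    have hnn : ∀ a ∈ Finset.univ, 0 ≤ π sh a * p s a s' :=
      fun a _ => mul_nonneg ((hπ sh).1 a) ((hp s a).1 s')
    have h0 : 0 ≤ phat π p s sh s' := Finset.sum_nonneg hnn
    rcases h0.lt_or_eq with h | h
    · rw [hRhat1 s sh s' hs h, mul_div_cancel₀ _ h.ne']
    · have hz := (Finset.sum_eq_zero_iff_of_nonneg hnn).1 h.symm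
      rw [← h, zero_mul]
      symm
      refine Finset.sum_eq_zero fun a ha => ?_
      rw [hz a ha, zero_mul]
  have hr : ∀ d : S → ℝ,
      stepReward ν (phat π p) Rhat d = stepReward (comp π ν) p Rbar d := by
    intro d
    simp only [stepReward]
    refine Finset.sum_congr rfl fun s _ => ?_
    congr 1
    have h1 : ∀ sh, ν s sh * ∑ s', phat π p s sh s' * Rhat s sh s'
        = ∑ a, ν s sh * π sh a * ∑ s', p s a s' * Rbar s a s' := by
      intro sh
      rcases ((hν s).1 sh).lt_or_eq with h | h
      · rw [Finset.sum_congr rfl fun s' _ => hone s sh s' (hsupp s sh h), Finset.sum_comm,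
          Finset.mul_sum]
        refine Finset.sum_congr rfl fun a _ => ?_
        simp only [Finset.mul_sum, mul_assoc]
      · simp [← h]
    rw [Finset.sum_congr rfl fun sh _ => h1 sh, Finset.sum_comm]
    refine Finset.sum_congr rfl fun a _ => ?_
    rw [← Finset.sum_mul]
    rfl
  intro s
  simp only [value, valueFrom, hd, hr]
end

section
/- Assume R̄ takes values in [m, M̄] and C < min{m, m/(1−γ) − γ·M̄/(1−γ)}. Let ν be a deterministic adversarial policy (each ν(·|s) is a point mass at a state denoted ν(s)) with ν(s⁰) ∉ B(s⁰) for some state s⁰ ∈ S. Then for every deterministic adversarial policy ν' satisfying ν'(s) ∈ B(s) for all s, one has V̂_ν(s⁰) < V̂_{ν'}(s⁰). In particular, no policy taking an action outside B at some state is uniformly optimal for M̂. -/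
open scoped BigOperators ENNReal

lemma phat_pmf_aux {S A : Type*} [Fintype S] [Fintype A]
    (π : S → A → ℝ) (hπ : ∀ s, IsPMF (π s))
    (p : S → A → S → ℝ) (hp : ∀ s a, IsPMF (p s a)) (s sh : S) : IsPMF (phat π p s sh) := by
  refine ⟨fun s' => Finset.sum_nonneg fun a _ => mul_nonneg ((hπ sh).1 a) ((hp s a).1 s'), ?_⟩
  simp only [phat]
  rw [Finset.sum_comm]
  simp only [← Finset.mul_sum, (hp s _).2, mul_one, (hπ sh).2]

lemma pmf_avg_le {X : Type*} [Fintype X] {q f : X → ℝ} (hq : IsPMF q) {K : ℝ}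
    (h : ∀ x, f x ≤ K) : ∑ x, q x * f x ≤ K := by
  calc ∑ x, q x * f x ≤ ∑ x, q x * K :=
        Finset.sum_le_sum fun x _ => mul_le_mul_of_nonneg_left (h x) (hq.1 x)
    _ = K := by rw [← Finset.sum_mul, hq.2, one_mul]

lemma le_pmf_avg {X : Type*} [Fintype X] {q f : X → ℝ} (hq : IsPMF q) {K : ℝ}
    (h : ∀ x, K ≤ f x) : K ≤ ∑ x, q x * f x := by
  calc K = ∑ x, q x * K := by rw [← Finset.sum_mul, hq.2, one_mul]
    _ ≤ ∑ x, q x * f x :=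
        Finset.sum_le_sum fun x _ => mul_le_mul_of_nonneg_left (h x) (hq.1 x)

lemma detPol_sum {S : Type*} [Fintype S] [DecidableEq S] (f : S → S) (s : S) (g : S → ℝ) :
    ∑ sh, detPol f s sh * g sh = g (f s) := by
  simp [detPol]

lemma stateDist_pmf_aux {S : Type*} [Fintype S] [DecidableEq S] (f : S → S)
    (q : S → S → S → ℝ) (hq : ∀ s sh, IsPMF (q s sh)) (d0 : S → ℝ) (hd : IsPMF d0) (t : ℕ) :
    IsPMF (stateDist (detPol f) q d0 t) := by
  induction t with
  | zero => exact hd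
  | succ t ih =>
    refine ⟨fun s' => ?_, ?_⟩
    · simp only [stateDist]
      refine Finset.sum_nonneg fun s _ => mul_nonneg (ih.1 s) ?_
      rw [detPol_sum f s (fun sh => q s sh s')]
      exact (hq _ _).1 _
    · simp only [stateDist]
      have : ∀ s s', ∑ a, detPol f s a * q s a s' = q s (f s) s' :=
        fun s s' => detPol_sum f s (fun sh => q s sh s')
      simp only [this]
      rw [Finset.sum_comm]
      simp only [← Finset.mul_sum, (hq _ _).2, mul_one, ih.2]

/-- a deterministic adversarial policy taking an action outside `B` at some state
`s⁰` is strictly worse at `s⁰` than every deterministic adversarial policy respecting `B`;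
in particular it is not uniformly optimal for `M̂`. -/
theorem stmt1 {S A : Type*} [Fintype S] [Fintype A] [Nonempty S] [Nonempty A] [DecidableEq S]
    (γ : ℝ) (hγ0 : 0 < γ) (hγ1 : γ < 1)
    (π : S → A → ℝ) (hπ : ∀ s, IsPMF (π s))
    (p : S → A → S → ℝ) (hp : ∀ s a, IsPMF (p s a))
    (B : S → Set S) (hB : ∀ s, (B s).Nonempty)
    (Rbar : S → A → S → ℝ) (m Mbar : ℝ)
    (hRl : ∀ s a s', m ≤ Rbar s a s') (hRu : ∀ s a s', Rbar s a s' ≤ Mbar)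
    (C : ℝ) (hC : C < min m (m / (1 - γ) - γ * Mbar / (1 - γ)))
    (Rhat : S → S → S → ℝ)
    (hRhat1 : ∀ s sh s', sh ∈ B s → 0 < phat π p s sh s' →
      Rhat s sh s' = (∑ a, π sh a * p s a s' * Rbar s a s') / phat π p s sh s')
    (hRhat2 : ∀ s sh s', sh ∉ B s → Rhat s sh s' = C)
    (ν : S → S) (s0 : S) (hν : ν s0 ∉ B s0) :
    (∀ ν' : S → S, (∀ s, ν' s ∈ B s) →
      value γ (detPol ν) (phat π p) Rhat s0 < value γ (detPol ν') (phat π p) Rhat s0) ∧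
    ¬ (∀ (ν'' : S → S) (s : S),
      value γ (detPol ν'') (phat π p) Rhat s ≤ value γ (detPol ν) (phat π p) Rhat s) := by
  have hm1 : C < m := lt_of_lt_of_le hC (min_le_left _ _)
  have hm2 : C < m / (1 - γ) - γ * Mbar / (1 - γ) := lt_of_lt_of_le hC (min_le_right _ _)
  have h1γ : 0 < 1 - γ := by linarith
  have hP := phat_pmf_aux π hπ p hp
  have hmM : m ≤ Mbar := by
    obtain ⟨a⟩ := ‹Nonempty A›
    exact (hRl s0 a s0).trans (hRu s0 a s0)
  let g : S → S → ℝ := fun s sh => ∑ s', phat π p s sh s' * Rhat s sh s'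
  have hgout : ∀ s sh, sh ∉ B s → g s sh = C := by
    intro s sh h
    simp only [g, hRhat2 s sh _ h, ← Finset.sum_mul, (hP s sh).2, one_mul]
  have hgin : ∀ s sh, sh ∈ B s → g s sh = ∑ a, π sh a * ∑ s', p s a s' * Rbar s a s' := by
    intro s sh h
    have : ∀ s', phat π p s sh s' * Rhat s sh s' = ∑ a, π sh a * p s a s' * Rbar s a s' := by
      intro s'
      rcases ((hP s sh).1 s').lt_or_eq with h0 | h0
      · rw [hRhat1 s sh s' h h0, mul_div_cancel₀ _ h0.ne']
      · rw [← h0, zero_mul]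
        have hz := h0.symm
        simp only [phat] at hz
        rw [Finset.sum_eq_zero_iff_of_nonneg
          (fun a _ => mul_nonneg ((hπ sh).1 a) ((hp s a).1 s'))] at hz
        exact (Finset.sum_eq_zero fun a ha => by rw [hz a ha, zero_mul]).symm
    simp only [g, this]
    rw [Finset.sum_comm]
    simp only [Finset.mul_sum, mul_assoc]
  have hglo : ∀ s sh, sh ∈ B s → m ≤ g s sh := by
    intro s sh h
    rw [hgin s sh h]
    exact le_pmf_avg (hπ sh) fun a => le_pmf_avg (hp s a) fun s' => hRl s a s'
  have hghi : ∀ s sh, g s sh ≤ Mbar := by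
    intro s sh
    by_cases h : sh ∈ B s
    · rw [hgin s sh h]
      exact pmf_avg_le (hπ sh) fun a => pmf_avg_le (hp s a) fun s' => hRu s a s'
    · rw [hgout s sh h]; linarith
  have hgC : ∀ s sh, C ≤ g s sh := by
    intro s sh
    by_cases h : sh ∈ B s
    · linarith [hglo s sh h]
    · rw [hgout s sh h]
  let d0 : S → ℝ := fun x => if x = s0 then 1 else 0
  have hd0 : IsPMF d0 := ⟨fun x => by simp only [d0]; split_ifs <;> norm_num, by simp [d0]⟩
  let u : (S → S) → ℕ → ℝ := fun f t =>
    stepReward (detPol f) (phat π p) Rhat (stateDist (detPol f) (phat π p) d0 t)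
  have hu : ∀ f t, u f t = ∑ s, stateDist (detPol f) (phat π p) d0 t s * g s (f s) := by
    intro f t
    simp only [u, stepReward]
    refine Finset.sum_congr rfl fun s _ => ?_
    rw [detPol_sum f s (g s)]
  have hD := fun f t => stateDist_pmf_aux f (phat π p) hP d0 hd0 t
  have huhi : ∀ f t, u f t ≤ Mbar := fun f t => by
    rw [hu]; exact pmf_avg_le (hD f t) fun s => hghi _ _
  have huC : ∀ f t, C ≤ u f t := fun f t => by
    rw [hu]; exact le_pmf_avg (hD f t) fun s => hgC _ _
  have hgeo := hasSum_geometric_of_lt_one hγ0.le hγ1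
  have hsum : ∀ f, Summable fun t => γ ^ t * u f t := by
    intro f
    refine Summable.of_norm_bounded (hgeo.summable.mul_right (max |C| |Mbar|)) fun t => ?_
    rw [norm_mul, Real.norm_eq_abs, Real.norm_eq_abs, abs_of_nonneg (pow_nonneg hγ0.le t)]
    exact mul_le_mul_of_nonneg_left (abs_le_max_abs_abs (huC f t) (huhi f t))
      (pow_nonneg hγ0.le t)
  have hval : ∀ f, value γ (detPol f) (phat π p) Rhat s0 = ∑' t, γ ^ t * u f t := fun f => rfl
  have key : ∀ ν' : S → S, (∀ s, ν' s ∈ B s) →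
      value γ (detPol ν) (phat π p) Rhat s0 < value γ (detPol ν') (phat π p) Rhat s0 := by
    intro ν' hν'
    have hlow : (1 - γ)⁻¹ * m ≤ ∑' t, γ ^ t * u ν' t := by
      refine hasSum_le (fun t => ?_) (hgeo.mul_right m) (hsum ν').hasSum
      refine mul_le_mul_of_nonneg_left ?_ (pow_nonneg hγ0.le t)
      rw [hu]; exact le_pmf_avg (hD ν' t) fun s => hglo _ _ (hν' s)
    have hu0 : u ν 0 = C := by
      rw [hu]
      simp [stateDist, d0, hgout s0 _ hν]
    have hup : ∑' t, γ ^ t * u ν t ≤ (1 - γ)⁻¹ * Mbar + (C - Mbar) := by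
      refine hasSum_le (fun t => ?_) (hsum ν).hasSum
        ((hgeo.mul_right Mbar).add (hasSum_ite_eq 0 (C - Mbar)))
      rcases Nat.eq_zero_or_pos t with rfl | ht
      · simp [hu0]
      · rw [if_neg ht.ne', add_zero]
        exact mul_le_mul_of_nonneg_left (huhi ν t) (pow_nonneg hγ0.le t)
    rw [hval, hval]
    refine hup.trans_lt (lt_of_lt_of_le ?_ hlow)
    have e : γ * Mbar / (1 - γ) = (1 - γ)⁻¹ * Mbar - Mbar := by
      field_simp; ring
    rw [e, div_eq_inv_mul] at hm2
    linarith
  refine ⟨key, fun h => ?_⟩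
  choose ν' hν' using hB
  exact absurd (h ν' s0) (not_le.mpr (key ν' hν'))
end

section
/- (Theorem 2.) Let π be a policy, ν an adversarial policy, and π∘ν the composite policy. Let R_tgt : S × A → ℝ and R̄_tgt > 0 satisfy |R_tgt(s,a)| ≤ R̄_tgt for all (s,a). Writing E_π[R_tgt] = Σ_{s,a} ρ_π(s,a) R_tgt(s,a) for the normalized discounted expectation, one has ( (1/(√2 · R̄_tgt)) · ( E_{π∘ν}[R_tgt] − E_π[R_tgt] ) )² ≤ Σ_{t≥0} (γ^t/(1−γ)) · E_{s∼d_π^t}[ D_KL( π(·|s) ‖ (π∘ν)(·|s) ) ]. -/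
open scoped BigOperators ENNReal

lemma inner_le_sq {S : Type*} [Fintype S] (d f : S → ℝ) (hd : ∀ s, 0 ≤ d s)
    (h1 : ∑ s, d s = 1) : (∑ s, d s * f s)^2 ≤ ∑ s, d s * f s^2 := by
  set m := ∑ s, d s * f s with hm
  have h : 0 ≤ ∑ s, d s * (f s - m)^2 :=
    Finset.sum_nonneg fun s _ => mul_nonneg (hd s) (sq_nonneg _)
  have e : ∑ s, d s * (f s - m)^2 = ∑ s, d s * f s^2 - 2 * m * (∑ s, d s * f s)
      + m^2 * ∑ s, d s := by
    clear_value m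
    rw [Finset.mul_sum, Finset.mul_sum, ← Finset.sum_sub_distrib, ← Finset.sum_add_distrib]
    exact Finset.sum_congr rfl fun s _ => by ring
  rw [e, h1, ← hm] at h
  nlinarith

lemma logbound_aux (x : ℝ) (hx : 0 < x) :
    HasDerivAt (fun x : ℝ => Real.log x - (x-1)*(5*x+1)/(2*x*(x+2)))
      ((x-1)^3/(x^2*(x+2)^2)) x := by
  have h2 : 2*x*(x+2) ≠ 0 := by positivity
  have h := (Real.hasDerivAt_log hx.ne').sub
    (((((hasDerivAt_id x).sub_const 1).mul (((hasDerivAt_id x).const_mul 5).add_const 1))).div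
      ((((hasDerivAt_id x).const_mul 2)).mul ((hasDerivAt_id x).add_const 2)) h2)
  refine h.congr_deriv ?_
  simp only [id, Pi.mul_apply]
  field_simp
  ring

lemma logbound (x : ℝ) (hx : 0 < x) : (x-1)*(5*x+1)/(2*x*(x+2)) ≤ Real.log x := by
  set g : ℝ → ℝ := fun x : ℝ => Real.log x - (x-1)*(5*x+1)/(2*x*(x+2)) with hg
  have hg1 : g 1 = 0 := by simp [hg]
  suffices 0 ≤ g x by simp only [hg] at this; linarith
  rcases le_total 1 x with h | h
  · have hm : MonotoneOn g (Set.Ici 1) := by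
      apply monotoneOn_of_deriv_nonneg (convex_Ici 1)
      · intro y hy
        exact (logbound_aux y (lt_of_lt_of_le one_pos hy)).continuousAt.continuousWithinAt
      · intro y hy
        rw [interior_Ici] at hy
        exact (logbound_aux y (lt_trans one_pos hy)).differentiableAt.differentiableWithinAt
      · intro y hy
        rw [interior_Ici] at hy
        have hy : 1 < y := hy
        rw [(logbound_aux y (lt_trans one_pos hy)).deriv]
        have : 0 < y - 1 := by linarith
        positivity
    rw [← hg1]
    exact hm (Set.mem_Ici.2 le_rfl) h h
  · have hm : AntitoneOn g (Set.Ioc 0 1) := by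
      apply antitoneOn_of_deriv_nonpos (convex_Ioc 0 1)
      · intro y hy
        exact (logbound_aux y hy.1).continuousAt.continuousWithinAt
      · intro y hy
        rw [interior_Ioc] at hy
        exact (logbound_aux y hy.1).differentiableAt.differentiableWithinAt
      · intro y hy
        rw [interior_Ioc] at hy
        rw [(logbound_aux y hy.1).deriv]
        apply div_nonpos_of_nonpos_of_nonneg _ (by positivity)
        have h3 : 0 < 1 - y := by linarith [hy.2]
        have : 0 < (1-y)^3 := by positivity
        nlinarith
    rw [← hg1]
    exact hm ⟨hx, h⟩ ⟨one_pos, le_rfl⟩ h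

lemma ptbound (a b : ℝ) (ha : 0 ≤ a) (hb : 0 ≤ b) (hab : 0 < a → 0 < b) :
    (a-b)^2 ≤ (2/3*(a+2*b)) * (a * Real.log (a/b) - a + b) := by
  rcases ha.eq_or_lt with h | h
  · subst h; simp; nlinarith [sq_nonneg b]
  · have hb := hab h
    have := logbound (a/b) (by positivity)
    have h2 : (a/b-1)*(5*(a/b)+1)/(2*(a/b)*(a/b+2)) = (a-b)*(5*a+b)/(2*a*(a+2*b)) := by
      field_simp
    rw [h2] at this
    have h3 : (2/3*(a+2*b)) * (a * ((a-b)*(5*a+b)/(2*a*(a+2*b))) - a + b) = (a-b)^2 := by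
      field_simp
      ring
    rw [← h3]
    gcongr

lemma pinsker {X : Type*} [Fintype X] (P Q : X → ℝ) (hP : IsPMF P) (hQ : IsPMF Q)
    (h : ∀ x, 0 < P x → 0 < Q x) :
    (∑ x, |P x - Q x|)^2 / 2 ≤ ∑ x, P x * Real.log (P x / Q x) := by
  have hk : ∀ x, 0 ≤ P x * Real.log (P x / Q x) - P x + Q x := by
    intro x
    have := ptbound _ _ (hP.1 x) (hQ.1 x) (h x)
    rcases (hP.1 x).eq_or_lt with h1 | h1
    · rw [← h1]; simpa using hQ.1 x
    · have := (sq_nonneg _).trans this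
      have h2 : 0 < 2/3*(P x + 2 * Q x) := by linarith [h x h1]
      exact (mul_nonneg_iff_of_pos_left h2).1 this
  have hw : ∀ x, 0 ≤ 2/3*(P x + 2 * Q x) := fun x => by linarith [hP.1 x, hQ.1 x]
  have hcs : (∑ x, |P x - Q x|)^2 ≤ (∑ x, 2/3*(P x + 2 * Q x)) *
      ∑ x, (P x * Real.log (P x / Q x) - P x + Q x) := by
    have h1 : ∑ x, |P x - Q x| ≤ ∑ x, √(2/3*(P x + 2 * Q x)) *
        √(P x * Real.log (P x / Q x) - P x + Q x) := by
      refine Finset.sum_le_sum fun x _ => ?_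
      rw [← Real.sqrt_mul (hw x)]
      apply Real.le_sqrt_of_sq_le
      rw [sq_abs]
      exact ptbound _ _ (hP.1 x) (hQ.1 x) (h x)
    have h2 := Finset.sum_mul_sq_le_sq_mul_sq Finset.univ (fun x => √(2/3*(P x + 2 * Q x)))
        (fun x => √(P x * Real.log (P x / Q x) - P x + Q x))
    simp only [Real.sq_sqrt (hw _), Real.sq_sqrt (hk _)] at h2
    exact (pow_le_pow_left₀ (Finset.sum_nonneg fun x _ => abs_nonneg _) h1 2).trans h2
  have e1 : (∑ x, 2/3*(P x + 2 * Q x)) = 2 := by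
    rw [← Finset.mul_sum, Finset.sum_add_distrib, ← Finset.mul_sum, hP.2, hQ.2]; norm_num
  have e2 : ∑ x, (P x * Real.log (P x / Q x) - P x + Q x) = ∑ x, P x * Real.log (P x / Q x) := by
    rw [Finset.sum_add_distrib, Finset.sum_sub_distrib, hP.2, hQ.2]; ring
  rw [e1, e2] at hcs
  linarith

lemma pinskerKL {X : Type*} [Fintype X] (P Q : X → ℝ) (hP : IsPMF P) (hQ : IsPMF Q) :
    ENNReal.ofReal ((∑ x, |P x - Q x|)^2 / 2) ≤ KL P Q := by
  unfold KL
  split_ifs with h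
  · exact ENNReal.ofReal_le_ofReal (pinsker P Q hP hQ h)
  · exact le_top

lemma comp_pmf {S A : Type*} [Fintype S] [Fintype A] (π : S → A → ℝ) (hπ : ∀ s, IsPMF (π s))
    (ν : S → S → ℝ) (hν : ∀ s, IsPMF (ν s)) (s : S) : IsPMF (comp π ν s) := by
  constructor
  · intro a
    exact Finset.sum_nonneg fun x _ => mul_nonneg ((hν s).1 x) ((hπ x).1 a)
  · simp only [comp]
    rw [Finset.sum_comm]
    simp_rw [← Finset.mul_sum, (hπ _).2, mul_one, (hν s).2]

section
variable {S A : Type*} [Fintype S] [Fintype A]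
    (γ : ℝ) (hγ0 : 0 < γ) (hγ1 : γ < 1)
    (p0 : S → ℝ) (hp0 : IsPMF p0)
    (π : S → A → ℝ) (hπ : ∀ s, IsPMF (π s))
    (p : S → A → S → ℝ) (hp : ∀ s a, IsPMF (p s a))

lemma stateDist_pmf (hp0 : IsPMF p0) (hπ : ∀ s, IsPMF (π s)) (hp : ∀ s a, IsPMF (p s a)) (t : ℕ) :
    IsPMF (stateDist π p p0 t) := by
  induction t with
  | zero => exact hp0
  | succ t ih =>
    constructor
    · intro s'
      exact Finset.sum_nonneg fun s _ => mul_nonneg (ih.1 s)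
        (Finset.sum_nonneg fun a _ => mul_nonneg ((hπ s).1 a) ((hp s a).1 s'))
    · simp only [stateDist]
      rw [Finset.sum_comm]
      simp_rw [← Finset.mul_sum]
      have : ∀ s, ∑ s', ∑ a, π s a * p s a s' = 1 := by
        intro s
        rw [Finset.sum_comm]
        simp_rw [← Finset.mul_sum, (hp s _).2, mul_one, (hπ s).2]
      simp_rw [this, mul_one, ih.2]

lemma sd_summable (hγ0 : 0 < γ) (hγ1 : γ < 1) (hp0 : IsPMF p0) (hπ : ∀ s, IsPMF (π s))
    (hp : ∀ s a, IsPMF (p s a)) (s : S) :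
    Summable (fun t : ℕ => γ ^ t * stateDist π p p0 t s) := by
  refine Summable.of_nonneg_of_le (fun t => ?_) (fun t => ?_)
    (summable_geometric_of_lt_one hγ0.le hγ1)
  · exact mul_nonneg (by positivity) ((stateDist_pmf p0 π p hp0 hπ hp t).1 s)
  · have h := stateDist_pmf p0 π p hp0 hπ hp t
    have : stateDist π p p0 t s ≤ 1 := by
      rw [← h.2]; exact Finset.single_le_sum (fun x _ => h.1 x) (Finset.mem_univ s)
    exact mul_le_of_le_one_right (by positivity) this

lemma dDisc_nonneg (hγ0 : 0 < γ) (hγ1 : γ < 1) (hp0 : IsPMF p0) (hπ : ∀ s, IsPMF (π s))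
    (hp : ∀ s a, IsPMF (p s a)) (s : S) : 0 ≤ dDisc γ π p p0 s :=
  mul_nonneg (by linarith) (tsum_nonneg fun t =>
    mul_nonneg (by positivity) ((stateDist_pmf p0 π p hp0 hπ hp t).1 s))

lemma dDisc_sum (hγ0 : 0 < γ) (hγ1 : γ < 1) (hp0 : IsPMF p0) (hπ : ∀ s, IsPMF (π s))
    (hp : ∀ s a, IsPMF (p s a)) : ∑ s, dDisc γ π p p0 s = 1 := by
  unfold dDisc
  rw [← Finset.mul_sum, ← Summable.tsum_finsetSum
    (fun s _ => sd_summable γ p0 π p hγ0 hγ1 hp0 hπ hp s)]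
  simp_rw [← Finset.mul_sum, (stateDist_pmf p0 π p hp0 hπ hp _).2, mul_one]
  rw [tsum_geometric_of_lt_one hγ0.le hγ1]
  exact mul_inv_cancel₀ (by linarith)

lemma dDisc_fix (hγ0 : 0 < γ) (hγ1 : γ < 1) (hp0 : IsPMF p0) (hπ : ∀ s, IsPMF (π s))
    (hp : ∀ s a, IsPMF (p s a)) (s' : S) :
    dDisc γ π p p0 s' = (1-γ) * p0 s' +
      γ * ∑ s, dDisc γ π p p0 s * ∑ a, π s a * p s a s' := by
  have hs := fun s => sd_summable γ p0 π p hγ0 hγ1 hp0 hπ hp s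
  have h1 : ∑' t : ℕ, γ ^ t * stateDist π p p0 t s' = p0 s' +
      γ * ∑ s, (∑' t : ℕ, γ ^ t * stateDist π p p0 t s) * ∑ a, π s a * p s a s' := by
    rw [(hs s').tsum_eq_zero_add]
    congr 1
    · simp [stateDist]
    · simp_rw [← tsum_mul_right]
      rw [← Summable.tsum_finsetSum (fun s _ => (hs s).mul_right _), ← tsum_mul_left]
      refine tsum_congr fun t => ?_
      simp only [stateDist]
      rw [Finset.mul_sum, Finset.mul_sum]
      refine Finset.sum_congr rfl fun s _ => ?_
      ring
  simp only [dDisc]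
  rw [h1, mul_add]
  congr 1
  simp_rw [mul_assoc]
  rw [← Finset.mul_sum]
  ring

/-- L1 bound on joint difference -/
lemma rho_l1 (d d' : S → ℝ) (hd : ∀ s, 0 ≤ d s) (π' : S → A → ℝ) (hπ' : ∀ s, IsPMF (π' s)) :
    ∑ s, ∑ a, |d' s * π' s a - d s * π s a| ≤
      ∑ s, d s * ∑ a, |π s a - π' s a| + ∑ s, |d' s - d s| := by
  rw [← Finset.sum_add_distrib]
  refine Finset.sum_le_sum fun s _ => ?_
  have : |d' s - d s| = ∑ a, |d' s - d s| * π' s a := by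
    rw [← Finset.mul_sum, (hπ' s).2, mul_one]
  rw [this, Finset.mul_sum, ← Finset.sum_add_distrib]
  refine Finset.sum_le_sum fun a _ => ?_
  have e : d' s * π' s a - d s * π s a =
    -(d s * (π s a - π' s a)) + (d' s - d s) * π' s a := by ring
  rw [e]
  refine (abs_add_le _ _).trans ?_
  rw [abs_neg, abs_mul, abs_mul, abs_of_nonneg (hd s), abs_of_nonneg ((hπ' s).1 a)]

lemma d_l1 (hγ0 : 0 < γ) (hγ1 : γ < 1) (hp0 : IsPMF p0) (hπ : ∀ s, IsPMF (π s))
    (hp : ∀ s a, IsPMF (p s a)) (π' : S → A → ℝ) (hπ' : ∀ s, IsPMF (π' s)) :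
    ∑ s, |dDisc γ π' p p0 s - dDisc γ π p p0 s| ≤
      γ * ∑ s, ∑ a, |dDisc γ π' p p0 s * π' s a - dDisc γ π p p0 s * π s a| := by
  have h1 : ∀ s', |dDisc γ π' p p0 s' - dDisc γ π p p0 s'| ≤
      γ * ∑ s, ∑ a, |dDisc γ π' p p0 s * π' s a - dDisc γ π p p0 s * π s a| * p s a s' := by
    intro s'
    have e : dDisc γ π' p p0 s' - dDisc γ π p p0 s' = γ * ∑ s, ∑ a,
        (dDisc γ π' p p0 s * π' s a - dDisc γ π p p0 s * π s a) * p s a s' := by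
      rw [dDisc_fix γ p0 π' p hγ0 hγ1 hp0 hπ' hp s', dDisc_fix γ p0 π p hγ0 hγ1 hp0 hπ hp s']
      simp_rw [sub_mul, Finset.sum_sub_distrib, mul_assoc, ← Finset.mul_sum]
      ring
    rw [e, abs_mul, abs_of_pos hγ0]
    refine mul_le_mul_of_nonneg_left ?_ hγ0.le
    refine (Finset.abs_sum_le_sum_abs _ _).trans (Finset.sum_le_sum fun s _ => ?_)
    refine (Finset.abs_sum_le_sum_abs _ _).trans (Finset.sum_le_sum fun a _ => ?_)
    rw [abs_mul, abs_of_nonneg ((hp s a).1 s')]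
  refine (Finset.sum_le_sum fun s' _ => h1 s').trans (le_of_eq ?_)
  rw [← Finset.mul_sum, Finset.sum_comm]
  congr 1
  refine Finset.sum_congr rfl fun s _ => ?_
  rw [Finset.sum_comm]
  refine Finset.sum_congr rfl fun a _ => ?_
  rw [← Finset.mul_sum, (hp s a).2, mul_one]

lemma real_bound (hγ0 : 0 < γ) (hγ1 : γ < 1) (hp0 : IsPMF p0) (hπ : ∀ s, IsPMF (π s))
    (hp : ∀ s a, IsPMF (p s a)) (π' : S → A → ℝ) (hπ' : ∀ s, IsPMF (π' s))
    (Rtgt : S → A → ℝ) (Rb : ℝ) (hRb : 0 < Rb) (hbound : ∀ s a, |Rtgt s a| ≤ Rb) :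
    (1 / (Real.sqrt 2 * Rb) *
        ((∑ z : S × A, rho γ π' p p0 z * Rtgt z.1 z.2) -
          ∑ z : S × A, rho γ π p p0 z * Rtgt z.1 z.2)) ^ 2 ≤
      1 / (1-γ)^2 * ∑ s, dDisc γ π p p0 s * ((∑ a, |π s a - π' s a|)^2/2) := by
  set d := dDisc γ π p p0 with hd
  set d' := dDisc γ π' p p0 with hd'
  have hdn := dDisc_nonneg γ p0 π p hγ0 hγ1 hp0 hπ hp
  have hds := dDisc_sum γ p0 π p hγ0 hγ1 hp0 hπ hp
  rw [← hd] at hdn hds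
  set L := ∑ s, ∑ a, |d' s * π' s a - d s * π s a| with hL
  set E := ∑ s, d s * ∑ a, |π s a - π' s a| with hE
  have a1 : L ≤ E + ∑ s, |d' s - d s| := rho_l1 π d d' hdn π' hπ'
  have a2 : ∑ s, |d' s - d s| ≤ γ * L := d_l1 γ p0 π p hγ0 hγ1 hp0 hπ hp π' hπ'
  have hγ : 0 < 1 - γ := by linarith
  have a3 : L ≤ E / (1-γ) := by rw [le_div_iff₀ hγ]; nlinarith
  have hL0 : 0 ≤ L := Finset.sum_nonneg fun s _ => Finset.sum_nonneg fun a _ => abs_nonneg _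
  have a4 : E^2 ≤ ∑ s, d s * (∑ a, |π s a - π' s a|)^2 := by
    exact inner_le_sq d (fun s => ∑ a, |π s a - π' s a|) hdn hds
  set G := (∑ z : S × A, rho γ π' p p0 z * Rtgt z.1 z.2) -
          ∑ z : S × A, rho γ π p p0 z * Rtgt z.1 z.2 with hG
  have a5 : |G| ≤ L * Rb := by
    rw [hG, ← Finset.sum_sub_distrib, Fintype.sum_prod_type, hL, Finset.sum_mul]
    refine (Finset.abs_sum_le_sum_abs _ _).trans (Finset.sum_le_sum fun s _ => ?_)
    rw [Finset.sum_mul]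
    refine (Finset.abs_sum_le_sum_abs _ _).trans (Finset.sum_le_sum fun a _ => ?_)
    simp only [rho]
    rw [← sub_mul, abs_mul]
    exact mul_le_mul_of_nonneg_left (hbound s a) (abs_nonneg _)
  have a6 : G^2 ≤ (L*Rb)^2 := by
    rw [← sq_abs]; exact pow_le_pow_left₀ (abs_nonneg _) a5 2
  have a7 : L^2 ≤ (E/(1-γ))^2 := pow_le_pow_left₀ hL0 a3 2
  simp_rw [← mul_div_assoc]
  rw [← Finset.sum_div, mul_pow, div_pow, mul_pow, Real.sq_sqrt (by norm_num), one_pow]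
  calc 1 / (2 * Rb^2) * G^2 ≤ 1 / (2 * Rb^2) * (L*Rb)^2 := by gcongr
    _ = L^2 / 2 := by field_simp
    _ ≤ (E/(1-γ))^2 / 2 := by gcongr
    _ = 1/(1-γ)^2 * (E^2/2) := by field_simp
    _ ≤ _ := by gcongr
end

/-- Theorem 2: the squared (scaled) gap between the normalized discounted
expectations of `R_tgt` under the composite policy `π∘ν` and under `π` is bounded by
`Σ_t γ^t/(1−γ) · E_{s∼d_π^t}[KL(π(·|s) ‖ (π∘ν)(·|s))]`. -/
theorem stmt4 {S A : Type*} [Fintype S] [Fintype A] [Nonempty S] [Nonempty A]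
    (γ : ℝ) (hγ0 : 0 < γ) (hγ1 : γ < 1)
    (p0 : S → ℝ) (hp0 : IsPMF p0)
    (π : S → A → ℝ) (hπ : ∀ s, IsPMF (π s))
    (p : S → A → S → ℝ) (hp : ∀ s a, IsPMF (p s a))
    (ν : S → S → ℝ) (hν : ∀ s, IsPMF (ν s))
    (Rtgt : S → A → ℝ) (Rb : ℝ) (hRb : 0 < Rb) (hbound : ∀ s a, |Rtgt s a| ≤ Rb) :
    ENNReal.ofReal ((1 / (Real.sqrt 2 * Rb) *
        ((∑ z : S × A, rho γ (comp π ν) p p0 z * Rtgt z.1 z.2) -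
          ∑ z : S × A, rho γ π p p0 z * Rtgt z.1 z.2)) ^ 2) ≤
      ∑' t : ℕ, ENNReal.ofReal (γ ^ t / (1 - γ)) *
        ∑ s, ENNReal.ofReal (stateDist π p p0 t s) * KL (π s) (comp π ν s) := by
  have hc := comp_pmf π hπ ν hν
  have hγ : 0 < 1 - γ := by linarith
  have hsd := stateDist_pmf p0 π p hp0 hπ hp
  have hs := sd_summable γ p0 π p hγ0 hγ1 hp0 hπ hp
  set K : S → ℝ := fun s => (∑ a, |π s a - comp π ν s a|)^2/2 with hK
  have hK0 : ∀ s, 0 ≤ K s := fun s => by simp only [hK]; positivity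
  refine (ENNReal.ofReal_le_ofReal (real_bound γ p0 π p hγ0 hγ1 hp0 hπ hp (comp π ν) hc
    Rtgt Rb hRb hbound)).trans ?_
  have h1 : ∀ t : ℕ, ENNReal.ofReal (∑ s, (1/(1-γ)) * (γ^t * stateDist π p p0 t s * K s)) ≤
      ENNReal.ofReal (γ ^ t / (1 - γ)) *
        ∑ s, ENNReal.ofReal (stateDist π p p0 t s) * KL (π s) (comp π ν s) := by
    intro t
    have : ∑ s, (1/(1-γ)) * (γ^t * stateDist π p p0 t s * K s) =
        (γ ^ t / (1 - γ)) * ∑ s, stateDist π p p0 t s * K s := by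
      rw [Finset.mul_sum]
      refine Finset.sum_congr rfl fun s _ => ?_
      ring
    rw [this, ENNReal.ofReal_mul (by positivity),
      ENNReal.ofReal_sum_of_nonneg (fun s _ => mul_nonneg ((hsd t).1 s) (hK0 s))]
    gcongr with s
    rw [ENNReal.ofReal_mul ((hsd t).1 s)]
    gcongr
    exact pinskerKL _ _ (hπ s) (hc s)
  have hsum : ∀ s, Summable fun t : ℕ => (1/(1-γ)) * (γ^t * stateDist π p p0 t s * K s) :=
    fun s => ((hs s).mul_right _).mul_left _
  refine le_trans (le_of_eq ?_) (ENNReal.tsum_le_tsum h1)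
  rw [← ENNReal.ofReal_tsum_of_nonneg]
  · congr 1
    rw [Summable.tsum_finsetSum (fun s _ => hsum s), Finset.mul_sum]
    refine Finset.sum_congr rfl fun s _ => ?_
    rw [tsum_mul_left, tsum_mul_right]
    simp only [dDisc, hK]
    field_simp
  · intro t
    exact Finset.sum_nonneg fun s _ => mul_nonneg (by positivity)
      (mul_nonneg (mul_nonneg (by positivity) ((hsd t).1 s)) (hK0 s))
  · exact summable_sum fun s _ => hsum s
end

section
/- Let π and π' be two policies on the same finite MDP, generating time-t state distributions d_π^t and d_{π'}^t from the common initial distribution p₀. Then for every t ≥ 1, D_KL(d_π^t ‖ d_{π'}^t) ≤ D_KL(d_π^{t−1} ‖ d_{π'}^{t−1}) + E_{s∼d_π^{t−1}}[ D_KL( π(·|s) ‖ π'(·|s) ) ]. -/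
open scoped BigOperators ENNReal

theorem logsum_aux {I : Type*} [Fintype I] (x y : I → ℝ) (hx : ∀ i, 0 ≤ x i)
    (hy : ∀ i, 0 ≤ y i) (h : ∀ i, 0 < x i → 0 < y i) :
    (∑ i, x i) * Real.log ((∑ i, x i) / (∑ i, y i)) ≤ ∑ i, x i * Real.log (x i / y i) := by
  rcases (Finset.sum_nonneg (fun i (_ : i ∈ Finset.univ) => hx i)).eq_or_lt with h0 | hX
  · have hz : ∀ i, x i = 0 := fun i =>
      (Finset.sum_eq_zero_iff_of_nonneg (fun i _ => hx i)).1 h0.symm i (Finset.mem_univ i)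
    simp [hz]
  · obtain ⟨i0, -, hi0⟩ := Finset.exists_lt_of_sum_lt (s := Finset.univ) (f := fun _ : I => (0:ℝ))
      (g := x) (by simpa using hX)
    have hY : 0 < ∑ i, y i :=
      Finset.sum_pos' (fun i _ => hy i) ⟨i0, Finset.mem_univ _, h i0 hi0⟩
    set X := ∑ i, x i with hXd
    set Y := ∑ i, y i with hYd
    have key : ∀ i, x i * Real.log (X / Y) + (x i - y i * (X / Y)) ≤ x i * Real.log (x i / y i) := by
      intro i
      rcases (hx i).eq_or_lt with h0 | hxi
      · rw [← h0]
        have := mul_nonneg (hy i) (div_pos hX hY).le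
        simp only [zero_mul]; linarith
      · have hyi := h i hxi
        have h1 := Real.log_le_sub_one_of_pos (mul_pos (div_pos hyi hxi) (div_pos hX hY))
        rw [Real.log_mul (div_pos hyi hxi).ne' (div_pos hX hY).ne'] at h1
        have h2 : Real.log (y i / x i) = - Real.log (x i / y i) := by
          rw [← Real.log_inv, inv_div]
        rw [h2] at h1
        have h3 := mul_le_mul_of_nonneg_left h1 hxi.le
        have h4 : x i * (y i / x i * (X / Y) - 1) = y i * (X / Y) - x i := by
          field_simp
        rw [h4] at h3
        linarith
    have := Finset.sum_le_sum (fun i (_ : i ∈ Finset.univ) => key i)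
    rw [Finset.sum_add_distrib, Finset.sum_sub_distrib, ← Finset.sum_mul, ← Finset.sum_mul,
      ← hXd, ← hYd] at this
    have h5 : Y * (X / Y) = X := by field_simp
    rw [h5] at this
    linarith

theorem stateDist_nonneg_aux {S A : Type*} [Fintype S] [Fintype A]
    (p0 : S → ℝ) (hp0 : IsPMF p0) (π : S → A → ℝ) (hπ : ∀ s, IsPMF (π s))
    (p : S → A → S → ℝ) (hp : ∀ s a, IsPMF (p s a)) (t : ℕ) :
    ∀ s, 0 ≤ stateDist π p p0 t s := by
  induction t with
  | zero => exact hp0.1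
  | succ n ih =>
    intro s
    exact Finset.sum_nonneg fun s1 _ => mul_nonneg (ih s1)
      (Finset.sum_nonneg fun a _ => mul_nonneg ((hπ s1).1 a) ((hp s1 a).1 s))

theorem step_real_aux {S A : Type*} [Fintype S] [Fintype A]
    (d d' : S → ℝ) (hd : ∀ s, 0 ≤ d s) (hd' : ∀ s, 0 ≤ d' s)
    (π π' : S → A → ℝ) (hπ : ∀ s, IsPMF (π s)) (hπ' : ∀ s, IsPMF (π' s))
    (p : S → A → S → ℝ) (hp : ∀ s a, IsPMF (p s a))
    (hac : ∀ s, 0 < d s → 0 < d' s)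
    (hac2 : ∀ s, 0 < d s → ∀ a, 0 < π s a → 0 < π' s a) :
    KL (fun s' => ∑ s, d s * ∑ a, π s a * p s a s')
      (fun s' => ∑ s, d' s * ∑ a, π' s a * p s a s') ≤
    ENNReal.ofReal ((∑ s, d s * Real.log (d s / d' s)) +
      ∑ s, d s * ∑ a, π s a * Real.log (π s a / π' s a)) := by
  have e : ∀ (d : S → ℝ) (π : S → A → ℝ) s', (∑ s, d s * ∑ a, π s a * p s a s') =
      ∑ z : S × A, d z.1 * π z.1 z.2 * p z.1 z.2 s' := by
    intro d π s'
    rw [Fintype.sum_prod_type]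
    simp only [Finset.mul_sum, mul_assoc]
  simp only [e]
  have hx : ∀ s' (z : S × A), 0 ≤ d z.1 * π z.1 z.2 * p z.1 z.2 s' := fun s' z =>
    mul_nonneg (mul_nonneg (hd _) ((hπ _).1 _)) ((hp _ _).1 _)
  have hy : ∀ s' (z : S × A), 0 ≤ d' z.1 * π' z.1 z.2 * p z.1 z.2 s' := fun s' z =>
    mul_nonneg (mul_nonneg (hd' _) ((hπ' _).1 _)) ((hp _ _).1 _)
  have hpos : ∀ s' (z : S × A), 0 < d z.1 * π z.1 z.2 * p z.1 z.2 s' →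
      0 < d z.1 ∧ 0 < π z.1 z.2 ∧ 0 < p z.1 z.2 s' := by
    intro s' z h
    refine ⟨(hd _).lt_of_ne' ?_, ((hπ _).1 _).lt_of_ne' ?_, ((hp _ _).1 _).lt_of_ne' ?_⟩ <;>
    · intro h0
      simp [h0] at h
  have hxy : ∀ s' (z : S × A), 0 < d z.1 * π z.1 z.2 * p z.1 z.2 s' →
      0 < d' z.1 * π' z.1 z.2 * p z.1 z.2 s' := by
    intro s' z h
    obtain ⟨h1, h2, h3⟩ := hpos s' z h
    exact mul_pos (mul_pos (hac _ h1) (hac2 _ h1 _ h2)) h3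
  rw [KL, if_pos]
  · apply ENNReal.ofReal_le_ofReal
    refine (Finset.sum_le_sum fun s' _ => logsum_aux _ _ (hx s') (hy s') (hxy s')).trans ?_
    have term : ∀ s' (z : S × A), d z.1 * π z.1 z.2 * p z.1 z.2 s' *
        Real.log (d z.1 * π z.1 z.2 * p z.1 z.2 s' / (d' z.1 * π' z.1 z.2 * p z.1 z.2 s')) =
        (d z.1 * π z.1 z.2 * (Real.log (d z.1 / d' z.1) + Real.log (π z.1 z.2 / π' z.1 z.2)))
          * p z.1 z.2 s' := by
      intro s' z
      rcases (hx s' z).eq_or_lt with h0 | h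
      · rw [← h0, zero_mul, mul_right_comm, ← h0, zero_mul]
      · obtain ⟨h1, h2, h3⟩ := hpos s' z h
        have h4 := hac _ h1
        have h5 := hac2 _ h1 _ h2
        rw [mul_div_mul_right _ _ h3.ne', mul_div_mul_comm,
          Real.log_mul (div_pos h1 h4).ne' (div_pos h2 h5).ne']
        ring
    simp only [term]
    rw [Finset.sum_comm]
    simp only [← Finset.mul_sum, (hp _ _).2, mul_one]
    rw [Fintype.sum_prod_type, ← Finset.sum_add_distrib]
    apply le_of_eq
    refine Finset.sum_congr rfl fun s _ => ?_
    have h1 := (hπ s).2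
    simp only [mul_add, Finset.sum_add_distrib]
    rw [← Finset.sum_mul, ← Finset.mul_sum, h1, mul_one, Finset.mul_sum]
    simp only [mul_assoc]
  · intro s' h
    obtain ⟨z, -, hz⟩ := Finset.exists_lt_of_sum_lt (s := Finset.univ)
      (f := fun _ : S × A => (0:ℝ)) (g := fun z => d z.1 * π z.1 z.2 * p z.1 z.2 s')
      (by simpa using h)
    exact Finset.sum_pos' (fun i _ => hy s' i) ⟨z, Finset.mem_univ _, hxy s' z hz⟩

/-- one-step recursion bound on the KL divergence between the time-`t` state
distributions of two policies started from the same initial distribution. -/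
theorem stmt5 {S A : Type*} [Fintype S] [Fintype A] [Nonempty S] [Nonempty A]
    (p0 : S → ℝ) (hp0 : IsPMF p0)
    (π π' : S → A → ℝ) (hπ : ∀ s, IsPMF (π s)) (hπ' : ∀ s, IsPMF (π' s))
    (p : S → A → S → ℝ) (hp : ∀ s a, IsPMF (p s a))
    (t : ℕ) (ht : 1 ≤ t) :
    KL (stateDist π p p0 t) (stateDist π' p p0 t) ≤
      KL (stateDist π p p0 (t - 1)) (stateDist π' p p0 (t - 1)) +
        ∑ s, ENNReal.ofReal (stateDist π p p0 (t - 1) s) * KL (π s) (π' s) := by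
  obtain ⟨n, rfl⟩ : ∃ n, t = n + 1 := ⟨t - 1, by omega⟩
  rw [Nat.add_sub_cancel]
  have hd := stateDist_nonneg_aux p0 hp0 π hπ p hp n
  have hd' := stateDist_nonneg_aux p0 hp0 π' hπ' p hp n
  simp only [stateDist]
  generalize stateDist π p p0 n = d at *
  generalize stateDist π' p p0 n = d' at *
  by_cases hac : ∀ s, 0 < d s → 0 < d' s
  swap
  · have : KL d d' = ⊤ := by rw [KL, if_neg hac]
    simp [this]
  by_cases hac2 : ∀ s, 0 < d s → ∀ a, 0 < π s a → 0 < π' s a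
  swap
  · push Not at hac2
    obtain ⟨s, hs, a, ha, ha'⟩ := hac2
    have h1 : KL (π s) (π' s) = ⊤ := by
      rw [KL, if_neg]
      exact fun h => absurd (h a ha) (not_lt.2 ha')
    have h2 : ∑ s, ENNReal.ofReal (d s) * KL (π s) (π' s) = ⊤ := by
      rw [ENNReal.sum_eq_top]
      refine ⟨s, Finset.mem_univ _, ?_⟩
      rw [h1, ENNReal.mul_top]
      simpa using hs
    simp [h2]
  refine (step_real_aux d d' hd hd' π π' hπ hπ' p hp hac hac2).trans ?_
  refine ENNReal.ofReal_add_le.trans ?_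
  refine add_le_add ?_ ?_
  · rw [KL, if_pos hac]
  · refine (Finset.le_sum_of_subadditive ENNReal.ofReal ENNReal.ofReal_zero.le
      (fun _ _ => ENNReal.ofReal_add_le) _ _).trans ?_
    refine Finset.sum_le_sum fun s _ => ?_
    rw [ENNReal.ofReal_mul (hd s)]
    rcases (hd s).eq_or_lt with h0 | hs
    · simp [← h0]
    · rw [KL, if_pos (hac2 s hs)]
end

section
/- For a fixed victim policy π on a finite MDP, the set 𝒟_{π∘ν} = { ρ̂_{π∘ν} : ν an adversarial policy } ⊆ ℝ^{S×A} of occupancy measures of composite policies is a compact subset of ℝ^{S×A}. -/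
open scoped BigOperators ENNReal

lemma comp_isPMF {S A : Type*} [Fintype S] [Fintype A] {π : S → A → ℝ} (hπ : ∀ s, IsPMF (π s))
    {ν : S → S → ℝ} (hν : ∀ s, IsPMF (ν s)) (s : S) : IsPMF (comp π ν s) := by
  refine ⟨fun a => Finset.sum_nonneg fun i _ => mul_nonneg ((hν s).1 i) ((hπ i).1 a), ?_⟩
  unfold comp
  rw [Finset.sum_comm]
  simp only [← Finset.mul_sum, (hπ _).2, mul_one, (hν s).2]

lemma stateDist_isPMF {S A : Type*} [Fintype S] [Fintype A] {π : S → A → ℝ}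
    (hπ : ∀ s, IsPMF (π s)) {p : S → A → S → ℝ} (hp : ∀ s a, IsPMF (p s a))
    {p0 : S → ℝ} (hp0 : IsPMF p0) (t : ℕ) : IsPMF (stateDist π p p0 t) := by
  induction t with
  | zero => exact hp0
  | succ t ih =>
    refine ⟨fun s' => Finset.sum_nonneg fun i _ => mul_nonneg (ih.1 i)
      (Finset.sum_nonneg fun a _ => mul_nonneg ((hπ i).1 a) ((hp i a).1 s')), ?_⟩
    simp only [stateDist]
    rw [Finset.sum_comm]
    simp only [← Finset.mul_sum]
    have h : ∀ s, ∑ s', ∑ a, π s a * p s a s' = 1 := by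
      intro s
      rw [Finset.sum_comm]
      simp only [← Finset.mul_sum, (hp _ _).2, mul_one, (hπ s).2]
    simp only [h, mul_one, ih.2]

lemma IsPMF.le_one {X : Type*} [Fintype X] {q : X → ℝ} (h : IsPMF q) (x : X) : q x ≤ 1 := by
  rw [← h.2]
  exact Finset.single_le_sum (fun i _ => h.1 i) (Finset.mem_univ x)

lemma continuous_comp_pol {S A : Type*} [Fintype S] (π : S → A → ℝ) (s : S) (a : A) :
    Continuous fun ν : S → S → ℝ => comp π ν s a := by
  unfold comp
  fun_prop

lemma continuous_stateDist {S A : Type*} [Fintype S] [Fintype A] (π : S → A → ℝ)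
    (p : S → A → S → ℝ) (p0 : S → ℝ) (t : ℕ) (s : S) :
    Continuous fun ν : S → S → ℝ => stateDist (comp π ν) p p0 t s := by
  induction t generalizing s with
  | zero => exact continuous_const
  | succ t ih =>
    simp only [stateDist]
    exact continuous_finset_sum _ fun i _ => (ih i).mul
      (continuous_finset_sum _ fun a _ => (continuous_comp_pol π i a).mul continuous_const)

/-- the set of occupancy measures of composite policies is compact in `ℝ^{S×A}`. -/
theorem stmt11 {S A : Type*} [Fintype S] [Fintype A] [Nonempty S] [Nonempty A]
    (γ : ℝ) (hγ0 : 0 < γ) (hγ1 : γ < 1)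
    (p0 : S → ℝ) (hp0 : IsPMF p0)
    (π : S → A → ℝ) (hπ : ∀ s, IsPMF (π s))
    (p : S → A → S → ℝ) (hp : ∀ s a, IsPMF (p s a)) :
    IsCompact {x : (S × A) → ℝ |
      ∃ ν : S → S → ℝ, (∀ s, IsPMF (ν s)) ∧ x = occ γ (comp π ν) p p0} := by
  have hK : IsCompact {ν : S → S → ℝ | ∀ s, IsPMF (ν s)} := by
    have := isCompact_univ_pi (fun _ : S => isCompact_stdSimplex ℝ S)
    convert this using 1
    ext ν
    simp [IsPMF, stdSimplex]
  have hc : ContinuousOn (fun ν : S → S → ℝ => occ γ (comp π ν) p p0)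
      {ν : S → S → ℝ | ∀ s, IsPMF (ν s)} := by
    refine continuousOn_pi.2 fun z => ?_
    refine continuousOn_tsum (u := fun t => γ ^ t) (fun t => ?_)
      (summable_geometric_of_lt_one hγ0.le hγ1) (fun t ν hν => ?_)
    · exact (continuous_const.mul ((continuous_stateDist π p p0 t z.1).mul
        (continuous_comp_pol π z.1 z.2))).continuousOn
    · have h1 := stateDist_isPMF (comp_isPMF hπ hν) hp hp0 t
      have h2 := comp_isPMF hπ hν z.1
      have h3 := mul_nonneg (h1.1 z.1) (h2.1 z.2)
      rw [Real.norm_of_nonneg (mul_nonneg (pow_nonneg hγ0.le t) h3)]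
      exact mul_le_of_le_one_right (pow_nonneg hγ0.le t)
        (mul_le_one₀ (h1.le_one _) (h2.1 _) (h2.le_one _))
  convert hK.image_of_continuousOn hc using 1
  ext x
  simp only [Set.mem_setOf_eq, Set.mem_image, eq_comm]
end

section
/- Let X be a finite nonempty set, P and Q probability mass functions on X, and f : X → ℝ a function with |f(x)| ≤ M̄ for all x ∈ X. Then ( Σ_x P(x) f(x) − Σ_x Q(x) f(x) )² ≤ 2 · M̄² · D_KL(P ‖ Q). -/
open scoped BigOperators ENNReal

theorem aux_hasDeriv (t : ℝ) (ht : 0 < t) :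
    HasDerivAt (fun t : ℝ => Real.log t - 1 + t⁻¹ - 3 * (t - 1) ^ 2 / (2 * t * (t + 2)))
      ((t - 1) ^ 3 / (t ^ 2 * (t + 2) ^ 2)) t := by
  have h1 := Real.hasDerivAt_log ht.ne'
  have h2 := hasDerivAt_inv ht.ne'
  have hid := hasDerivAt_id' t
  have h3 := ((hid.sub_const 1).pow 2).const_mul 3
  have h4 := (hid.const_mul 2).mul (hid.add_const 2)
  have hne : 2 * t * (t + 2) ≠ 0 := by positivity
  have h5 := ((h1.sub_const 1).add h2).sub (h3.div h4 hne)
  refine h5.congr_deriv ?_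
  have : t + 2 ≠ 0 := by positivity
  simp
  field_simp
  ring

theorem aux_log (t : ℝ) (ht : 0 < t) :
    0 ≤ Real.log t - 1 + t⁻¹ - 3 * (t - 1) ^ 2 / (2 * t * (t + 2)) := by
  set g : ℝ → ℝ := fun t : ℝ => Real.log t - 1 + t⁻¹ - 3 * (t - 1) ^ 2 / (2 * t * (t + 2)) with hg
  have g1 : g 1 = 0 := by simp [hg]
  change 0 ≤ g t
  rw [← g1]
  rcases le_total 1 t with h | h
  · have hm : MonotoneOn g (Set.Ici 1) := by
      apply monotoneOn_of_deriv_nonneg (convex_Ici 1)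
      · intro x hx
        exact (aux_hasDeriv x (lt_of_lt_of_le one_pos hx)).continuousAt.continuousWithinAt
      · intro x hx
        rw [interior_Ici] at hx
        exact (aux_hasDeriv x (lt_trans one_pos hx)).differentiableAt.differentiableWithinAt
      · intro x hx
        rw [interior_Ici] at hx
        rw [(aux_hasDeriv x (lt_trans one_pos hx)).deriv]
        have : 0 ≤ x - 1 := sub_nonneg.2 (le_of_lt hx)
        positivity
    exact hm (Set.mem_Ici.2 le_rfl) h h
  · have hm : AntitoneOn g (Set.Ioc 0 1) := by
      apply antitoneOn_of_deriv_nonpos (convex_Ioc 0 1)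
      · intro x hx
        exact (aux_hasDeriv x hx.1).continuousAt.continuousWithinAt
      · intro x hx
        rw [interior_Ioc] at hx
        exact (aux_hasDeriv x hx.1).differentiableAt.differentiableWithinAt
      · intro x hx
        rw [interior_Ioc] at hx
        rw [(aux_hasDeriv x hx.1).deriv]
        apply div_nonpos_of_nonpos_of_nonneg
        · exact Odd.pow_nonpos (by decide) (sub_nonpos.2 hx.2.le)
        · positivity
    exact hm ⟨ht, h⟩ ⟨one_pos, le_rfl⟩ h

theorem aux_pt (p q : ℝ) (hp : 0 ≤ p) (hq : 0 ≤ q) (hpq : 0 < p → 0 < q) :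
    0 ≤ p * Real.log (p / q) - p + q ∧
    (p - q) ^ 2 ≤ (2 / 3 * (p + 2 * q)) * (p * Real.log (p / q) - p + q) := by
  rcases hp.eq_or_lt with rfl | hp0
  · constructor
    · simpa using hq
    · simp; nlinarith [sq_nonneg q]
  · have hq0 := hpq hp0
    have h := aux_log (p / q) (by positivity)
    have e : Real.log (p / q) - 1 + (p / q)⁻¹ - 3 * (p / q - 1) ^ 2 / (2 * (p / q) * (p / q + 2))
        = ((p * Real.log (p / q) - p + q) - 3 * (p - q) ^ 2 / (2 * (p + 2 * q))) / p := by
      generalize Real.log (p / q) = L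
      field_simp
    rw [e] at h
    have h2 : 0 ≤ (p * Real.log (p / q) - p + q) - 3 * (p - q) ^ 2 / (2 * (p + 2 * q)) := by
      have := mul_nonneg h hp0.le
      rwa [div_mul_cancel₀ _ hp0.ne'] at this
    have h3 : 3 * (p - q) ^ 2 / (2 * (p + 2 * q)) ≤ p * Real.log (p / q) - p + q := by linarith
    refine ⟨le_trans (by positivity) h3, ?_⟩
    rw [div_le_iff₀ (by positivity)] at h3
    linarith

theorem aux_real {X : Type*} [Fintype X]
    (P Q : X → ℝ) (hP : IsPMF P) (hQ : IsPMF Q)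
    (f : X → ℝ) (M : ℝ) (hf : ∀ x, |f x| ≤ M) (hac : ∀ x, 0 < P x → 0 < Q x) :
    (∑ x, P x * f x - ∑ x, Q x * f x) ^ 2 ≤
      2 * M ^ 2 * ∑ x, P x * Real.log (P x / Q x) := by
  have hpt := fun x => aux_pt (P x) (Q x) (hP.1 x) (hQ.1 x) (hac x)
  have key := Finset.sum_sq_le_sum_mul_sum_of_sq_le_mul Finset.univ
    (r := fun x => (P x - Q x) * f x)
    (f := fun x => 2 / 3 * (P x + 2 * Q x))
    (g := fun x => M ^ 2 * (P x * Real.log (P x / Q x) - P x + Q x))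
    (fun x _ => by have := hP.1 x; have := hQ.1 x; positivity)
    (fun x _ => mul_nonneg (sq_nonneg _) (hpt x).1)
    (fun x _ => by
      have h1 : f x ^ 2 ≤ M ^ 2 := sq_le_sq' (abs_le.1 (hf x)).1 (abs_le.1 (hf x)).2
      have h2 := mul_le_mul (hpt x).2 h1 (sq_nonneg _)
        (le_trans (sq_nonneg _) (hpt x).2)
      rw [mul_pow]
      linarith)
  have e1 : ∑ x, (P x - Q x) * f x = ∑ x, P x * f x - ∑ x, Q x * f x := by
    simp [sub_mul, Finset.sum_sub_distrib]
  have e2 : ∑ x, 2 / 3 * (P x + 2 * Q x) = 2 := by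
    rw [← Finset.mul_sum, Finset.sum_add_distrib, ← Finset.mul_sum, hP.2, hQ.2]; norm_num
  have e3 : ∑ x, M ^ 2 * (P x * Real.log (P x / Q x) - P x + Q x)
      = M ^ 2 * ∑ x, P x * Real.log (P x / Q x) := by
    rw [← Finset.mul_sum, Finset.sum_add_distrib, Finset.sum_sub_distrib, hP.2, hQ.2]; ring
  rw [e1, e2, e3] at key
  linarith

/-- a Pinsker-type bound: for pmfs `P, Q` on a finite set and `|f| ≤ M̄`,
`(Σ P f − Σ Q f)² ≤ 2 M̄² D_KL(P‖Q)`. -/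
theorem stmt13 {X : Type*} [Fintype X] [Nonempty X]
    (P Q : X → ℝ) (hP : IsPMF P) (hQ : IsPMF Q)
    (f : X → ℝ) (Mbar : ℝ) (hf : ∀ x, |f x| ≤ Mbar) :
    ENNReal.ofReal ((∑ x, P x * f x - ∑ x, Q x * f x) ^ 2) ≤
      ENNReal.ofReal (2 * Mbar ^ 2) * KL P Q := by
  by_cases hac : ∀ x, 0 < P x → 0 < Q x
  · rw [KL, if_pos hac, ← ENNReal.ofReal_mul (by positivity)]
    exact ENNReal.ofReal_le_ofReal (aux_real P Q hP hQ f Mbar hf hac)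
  · rw [KL, if_neg hac]
    by_cases hM : Mbar = 0
    · have hf0 : ∀ x, f x = 0 := fun x => by
        have := hf x
        rw [hM] at this
        exact abs_nonpos_iff.1 this
      simp [hf0]
    · rw [ENNReal.mul_top]
      · exact le_top
      · have : 0 < 2 * Mbar ^ 2 := by positivity
        exact (ENNReal.ofReal_pos.2 this).ne'
end
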